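/- arXiv:1909.05578 — 2 statements merged into one kernel-verified Lean document; each statement's English description precedes it below -/
import Mathlib

section
/- Let p : ℝ → ℝ be odd (p(−x) = −p(x) for all x), nondecreasing, with lim_{Δ→0} p(Δ) = 0, let b₁ + b₂ = 2 with b₁ ≥ b₂ > 0, p_d > 0, and define the spot price p_s(Δ) = p(Δ) + b₁·p_d for Δ > 0, p_s(Δ) = p(Δ) + b₂·p_d for Δ < 0, p_s(0) = p_d. Let φ and g be probability densities on ℝ, each symmetric unimodal about 0, let D > 0, and define C(μ) := ∬_{ℝ×ℝ} [ p_d + δ·(p_s(δ + s) − p_d)/D ] · φ(δ − μ) · g(s) ds dδ. Then: (i) C(0) ≤ C(μ) for all μ, i.e., μ = 0 minimizes C; (ii) C is nondecreasing with respect to |μ|: |μ₂| ≤ |μ₁| implies C(μ₂) ≤ C(μ₁); and (iii) if p is strictly increasing or b₁ > b₂, then C is strictly increasing with respect to |μ|. Consequently all utilities bidding according to prediction is a pure strategy Nash equilibrium. -/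
open MeasureTheory

/-- A probability density on `ℝ`: measurable, nonnegative, integrating to 1. -/
def IsDensity (f : ℝ → ℝ) : Prop :=
  Measurable f ∧ (∀ x, 0 ≤ f x) ∧ ∫ x, f x = 1

/-- `f` is symmetric unimodal about `ξ`. -/
def SymmUnimodal (f : ℝ → ℝ) (ξ : ℝ) : Prop :=
  IsDensity f ∧ (∀ x, f (ξ + x) = f (ξ - x)) ∧
    ∀ x y, |y - ξ| ≤ |x - ξ| → f x ≤ f y

/-- General symmetric spot pricing with day-ahead price `pd`, built from an odd
nondecreasing `p` and a possible discontinuity gap `b₁ - b₂` at the origin. -/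
noncomputable def genSpot (p : ℝ → ℝ) (b₁ b₂ pd : ℝ) (Δ : ℝ) : ℝ :=
  if 0 < Δ then p Δ + b₁ * pd
  else if Δ < 0 then p Δ + b₂ * pd
  else pd

lemma aux_comp {T : ℝ × ℝ → ℝ × ℝ} (hT : MeasurePreserving T volume volume)
    {J : ℝ × ℝ → ℝ} (hJ : Integrable J) :
    Integrable (fun x => J (T x)) ∧ ∫ x, J (T x) = ∫ x, J x := by
  refine ⟨hT.integrable_comp_of_integrable hJ, ?_⟩
  have h := integral_map (μ := (volume : Measure (ℝ × ℝ))) (φ := T)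
    hT.measurable.aemeasurable (f := J) (by rw [hT.map_eq]; exact hJ.aestronglyMeasurable)
  rw [hT.map_eq] at h
  exact h.symm

lemma aux_T (u v : ℝ → ℝ) (hu : MeasurePreserving u volume volume)
    (hv : MeasurePreserving v volume volume) :
    MeasurePreserving (fun x : ℝ × ℝ => (u x.1, v x.2)) volume volume :=
  hu.prod hv

lemma aux_add (m : ℝ) : MeasurePreserving (fun t : ℝ => m + t) volume volume :=
  measurePreserving_add_left volume m

lemma aux_sub (m : ℝ) : MeasurePreserving (fun t : ℝ => m - t) volume volume :=
  Measure.measurePreserving_sub_left volume m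

lemma aux_neg : MeasurePreserving (fun t : ℝ => -t) volume volume :=
  Measure.measurePreserving_neg volume

lemma aux_id : MeasurePreserving (fun t : ℝ => t) volume volume :=
  MeasurePreserving.id volume

/-- the symmetrized payoff -/
def auxA (q : ℝ → ℝ) (x s : ℝ) : ℝ := x * (q (x + s) + q (x - s))

lemma auxA_abs (q : ℝ → ℝ) (hodd : ∀ x, q (-x) = -q x) (x s : ℝ) :
    auxA q |x| s = auxA q x s := by
  rcases abs_choice x with h | h
  · rw [h]
  · rw [h]
    unfold auxA
    rw [show -x + s = -(x - s) by ring, show -x - s = -(x + s) by ring, hodd, hodd]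
    ring

lemma auxB_nonneg (q : ℝ → ℝ) (hodd : ∀ x, q (-x) = -q x) (hm : Monotone q)
    (x s : ℝ) (hx : 0 ≤ x) : 0 ≤ q (x + s) + q (x - s) := by
  have h1 : q s ≤ q (x + s) := hm (by linarith)
  have h2 : q (-s) ≤ q (x - s) := hm (by linarith)
  rw [hodd] at h2
  linarith

lemma auxA_mono (q : ℝ → ℝ) (hodd : ∀ x, q (-x) = -q x) (hm : Monotone q)
    (x y s : ℝ) (h : |y| ≤ |x|) : auxA q y s ≤ auxA q x s := by
  rw [← auxA_abs q hodd x, ← auxA_abs q hodd y]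
  unfold auxA
  have h1 : q (|y| + s) ≤ q (|x| + s) := hm (by linarith)
  have h2 : q (|y| - s) ≤ q (|x| - s) := hm (by linarith)
  exact mul_le_mul h (by linarith) (auxB_nonneg q hodd hm _ _ (abs_nonneg _)) (abs_nonneg _)

lemma auxA_strict (q : ℝ → ℝ) (hodd : ∀ x, q (-x) = -q x) (hm : Monotone q)
    (hpos : ∀ x, 0 < x → 0 < q x)
    (x y s : ℝ) (h : |y| < |x|) (hs : |s| < |x|) : auxA q y s < auxA q x s := by
  rw [← auxA_abs q hodd x, ← auxA_abs q hodd y]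
  unfold auxA
  have h1 : q (|y| + s) ≤ q (|x| + s) := hm (by linarith)
  have h2 : q (|y| - s) ≤ q (|x| - s) := hm (by linarith)
  have hs' := abs_lt.1 hs
  have h3 := hpos (|x| + s) (by linarith)
  have h4 := hpos (|x| - s) (by linarith)
  have h5 := abs_nonneg y
  nlinarith

lemma aux_integrable {f : ℝ → ℝ} (hf : SymmUnimodal f 0) : Integrable f := by
  by_contra h
  have := hf.1.2.2
  rw [integral_undef h] at this
  norm_num at this

lemma aux_even {f : ℝ → ℝ} (hf : SymmUnimodal f 0) (x : ℝ) : f (-x) = f x := by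
  have := hf.2.1 x
  simp at this
  exact this.symm

lemma aux_anti {f : ℝ → ℝ} (hf : SymmUnimodal f 0) (x y : ℝ) (h : |y| ≤ |x|) : f x ≤ f y := by
  apply hf.2.2
  simpa using h

lemma aux_pos {f : ℝ → ℝ} (hf : SymmUnimodal f 0) :
    ∃ r > 0, ∀ x, |x| ≤ r → 0 < f x := by
  have key : ∃ r ≠ 0, 0 < f r := by
    by_contra hc
    push Not at hc
    have h0 : f =ᵐ[volume] fun _ => (0 : ℝ) := by
      have : ∀ᵐ x : ℝ, x ≠ 0 := by simp [ae_iff]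
      filter_upwards [this] with x hx
      exact le_antisymm (hc x hx) (hf.1.2.1 x)
    have := hf.1.2.2
    rw [integral_congr_ae h0] at this
    simp at this
  obtain ⟨r, hr, hfr⟩ := key
  refine ⟨|r|, abs_pos.2 hr, fun x hx => hfr.trans_le (aux_anti hf _ _ hx)⟩

lemma aux_setpos {f : ℝ → ℝ} (hf : SymmUnimodal f 0) (m : ℝ) (hm : 0 < m) :
    0 < volume {s : ℝ | |s| < m ∧ 0 < f s} := by
  obtain ⟨r, hr, h⟩ := aux_pos hf
  have hsub : Set.Ioo 0 (min m r) ⊆ {s : ℝ | |s| < m ∧ 0 < f s} := by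
    intro s hs
    have h1 := hs.1
    have h2 := lt_min_iff.1 hs.2
    refine ⟨by rw [abs_of_pos h1]; exact h2.1, h s (by rw [abs_of_pos h1]; exact h2.2.le)⟩
  refine lt_of_lt_of_le ?_ (measure_mono hsub)
  rw [Real.volume_Ioo]
  simp [hm, hr]

lemma aux_setpos2 {f : ℝ → ℝ} (hf : SymmUnimodal f 0) (d : ℝ) (hd : 0 < d) :
    0 < volume {t : ℝ | 0 < t ∧ f (t + d) < f (t - d)} := by
  by_contra hc
  have hz : volume {t : ℝ | 0 < t ∧ f (t + d) < f (t - d)} = 0 := by simpa using hc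
  have hae : ∀ᵐ t : ℝ, t ∈ Set.Ioi (0 : ℝ) → f (t + d) = f (t - d) := by
    have : ∀ᵐ t : ℝ, ¬ (0 < t ∧ f (t + d) < f (t - d)) := by
      rw [ae_iff]; simpa using hz
    filter_upwards [this] with t ht h0
    have h0' : 0 < t := h0
    apply le_antisymm
    · apply aux_anti hf
      rw [abs_of_pos (by linarith : 0 < t + d)]
      exact abs_le.2 ⟨by linarith, by linarith⟩
    · by_contra hlt
      exact ht ⟨h0', not_le.1 hlt⟩
  have hi := aux_integrable hf
  have h1 : ∫ t in Set.Ioi (0 : ℝ), f (t + d) = ∫ t in Set.Ioi (0 : ℝ), f (t - d) :=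
    setIntegral_congr_ae measurableSet_Ioi hae
  have h2 : ∫ t in Set.Ioi (0 : ℝ), f (t + d) = ∫ t in Set.Ioi d, f t := by
    have := (measurePreserving_add_right volume d).setIntegral_preimage_emb
      (measurableEmbedding_addRight d) f (Set.Ioi d)
    rw [← this]
    congr 2
    ext; simp
  have h3 : ∫ t in Set.Ioi (0 : ℝ), f (t - d) = ∫ t in Set.Ioi (-d), f t := by
    have := (measurePreserving_add_right volume (-d)).setIntegral_preimage_emb
      (measurableEmbedding_addRight (-d)) f (Set.Ioi (-d))
    rw [← this]
    simp only [sub_eq_add_neg]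
    congr 2
    ext; simp
  have h4 : ∫ t in Set.Ioi (-d), f t = (∫ t in Set.Ioc (-d) d, f t) + ∫ t in Set.Ioi d, f t := by
    rw [← setIntegral_union (Set.Ioc_disjoint_Ioi le_rfl) measurableSet_Ioi
      hi.integrableOn hi.integrableOn, Set.Ioc_union_Ioi_eq_Ioi (by linarith)]
  have h5 : ∫ t in Set.Ioc (-d) d, f t = 0 := by linarith
  have h6 := (setIntegral_eq_zero_iff_of_nonneg_ae
    (Filter.Eventually.of_forall (fun x => hf.1.2.1 x)) hi.integrableOn).1 h5
  rw [Filter.EventuallyEq, ae_restrict_iff' measurableSet_Ioc, ae_iff] at h6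
  have h7 := aux_setpos hf d hd
  refine absurd (measure_mono_null ?_ h6) h7.ne'
  rintro s ⟨hs, hs2⟩
  have := abs_lt.1 hs
  simp only [Set.mem_setOf_eq]
  intro hh
  exact hs2.ne' (hh ⟨this.1, this.2.le⟩)

lemma aux_main (q : ℝ → ℝ) (hodd : ∀ x, q (-x) = -q x) (hm : Monotone q)
    {φ g : ℝ → ℝ} (hφ : SymmUnimodal φ 0) (hg : SymmUnimodal g 0)
    (J : ℝ → ℝ × ℝ → ℝ)
    (hJ : ∀ μ x, J μ x = x.1 * q (x.1 + x.2) * (φ (x.1 - μ) * g x.2))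
    (hi : ∀ μ, Integrable (J μ)) (μ₁ μ₂ : ℝ) (h2 : 0 ≤ μ₂) (h12 : μ₂ < μ₁) :
    (∫ x, J μ₂ x) ≤ (∫ x, J μ₁ x) ∧
    ((∀ x, 0 < x → 0 < q x) → (∫ x, J μ₂ x) < ∫ x, J μ₁ x) := by
  obtain ⟨m, hmdef⟩ : ∃ m, m = (μ₁ + μ₂) / 2 := ⟨_, rfl⟩
  obtain ⟨d, hddef⟩ : ∃ d, d = (μ₁ - μ₂) / 2 := ⟨_, rfl⟩
  have hm0 : 0 < m := by linarith
  have hd0 : 0 < d := by linarith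
  have e1 : μ₁ = m + d := by linarith
  have e2 : μ₂ = m - d := by linarith
  let W : ℝ × ℝ → ℝ := fun x =>
    (auxA q (m + x.1) x.2 - auxA q (m - x.1) x.2) * (φ (x.1 - d) - φ (x.1 + d)) * g x.2
  have T1 := aux_T _ _ (aux_add m) aux_id
  have T2 := aux_T _ _ (aux_add m) aux_neg
  have T3 := aux_T _ _ (aux_sub m) aux_id
  have T4 := aux_T _ _ (aux_sub m) aux_neg
  have hW : W = fun x => (J μ₁ (m + x.1, x.2) - J μ₂ (m + x.1, x.2))
      + (J μ₁ (m + x.1, -x.2) - J μ₂ (m + x.1, -x.2))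
      + (J μ₁ (m - x.1, x.2) - J μ₂ (m - x.1, x.2))
      + (J μ₁ (m - x.1, -x.2) - J μ₂ (m - x.1, -x.2)) := by
    funext x
    simp only [W, hJ, auxA, aux_even hg]
    rw [e1, e2, show m + x.1 - (m + d) = x.1 - d by ring,
      show m + x.1 - (m - d) = x.1 + d by ring,
      show m - x.1 - (m + d) = -(x.1 + d) by ring,
      show m - x.1 - (m - d) = -(x.1 - d) by ring, aux_even hφ, aux_even hφ]
    simp only [← sub_eq_add_neg]
    ring
  have P1 := aux_comp T1 (hi μ₁)
  have P2 := aux_comp T2 (hi μ₁)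
  have P3 := aux_comp T3 (hi μ₁)
  have P4 := aux_comp T4 (hi μ₁)
  have Q1 := aux_comp T1 (hi μ₂)
  have Q2 := aux_comp T2 (hi μ₂)
  have Q3 := aux_comp T3 (hi μ₂)
  have Q4 := aux_comp T4 (hi μ₂)
  have R1 := P1.1.sub Q1.1
  have R2 := P2.1.sub Q2.1
  have R3 := P3.1.sub Q3.1
  have R4 := P4.1.sub Q4.1
  have hWi : Integrable W := by
    rw [hW]; exact ((R1.add R2).add R3).add R4
  have hWint : ∫ x, W x = 4 * ((∫ x, J μ₁ x) - ∫ x, J μ₂ x) := by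
    have a1 := integral_sub P1.1 Q1.1
    have a2 := integral_sub P2.1 Q2.1
    have a3 := integral_sub P3.1 Q3.1
    have a4 := integral_sub P4.1 Q4.1
    have b1 := integral_add R1 R2
    have b2 := integral_add (R1.add R2) R3
    have b3 := integral_add ((R1.add R2).add R3) R4
    simp only [Pi.add_apply, Pi.sub_apply] at b1 b2 b3
    rw [hW, b3, b2, b1, a1, a2, a3, a4, P1.2, P2.2, P3.2, P4.2, Q1.2, Q2.2, Q3.2, Q4.2]
    ring
  have hW0 : ∀ x, 0 ≤ W x := by
    intro x
    refine mul_nonneg ?_ (hg.1.2.1 _)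
    rcases le_total 0 x.1 with h | h
    · apply mul_nonneg
      · rw [sub_nonneg]
        apply auxA_mono q hodd hm
        rw [abs_of_nonneg (by linarith : 0 ≤ m + x.1)]
        exact abs_le.2 ⟨by linarith, by linarith⟩
      · rw [sub_nonneg]
        apply aux_anti hφ
        rw [abs_of_nonneg (by linarith : 0 ≤ x.1 + d)]
        exact abs_le.2 ⟨by linarith, by linarith⟩
    · apply mul_nonneg_of_nonpos_of_nonpos
      · rw [sub_nonpos]
        apply auxA_mono q hodd hm
        rw [abs_of_nonneg (by linarith : 0 ≤ m - x.1)]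
        exact abs_le.2 ⟨by linarith, by linarith⟩
      · rw [sub_nonpos]
        apply aux_anti hφ
        rw [abs_of_nonpos (by linarith : x.1 - d ≤ 0)]
        exact abs_le.2 ⟨by linarith, by linarith⟩
  have hle : 0 ≤ ∫ x, W x := integral_nonneg hW0
  refine ⟨by linarith, fun hpos => ?_⟩
  rcases hle.lt_or_eq with h | h
  · linarith
  exfalso
  have hz := (integral_eq_zero_iff_of_nonneg hW0 hWi).1 h.symm
  rw [Filter.EventuallyEq, ae_iff] at hz
  have hsub : {t : ℝ | 0 < t ∧ φ (t + d) < φ (t - d)} ×ˢ {s : ℝ | |s| < m ∧ 0 < g s}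
      ⊆ {x | ¬ W x = (0 : ℝ × ℝ → ℝ) x} := by
    rintro ⟨t, s⟩ ⟨⟨ht, ht2⟩, hs, hs2⟩
    simp only at ht ht2 hs hs2
    have hA : auxA q (m - t) s < auxA q (m + t) s := by
      apply auxA_strict q hodd hm hpos
      · rw [abs_of_nonneg (by linarith : 0 ≤ m + t)]
        exact abs_lt.2 ⟨by linarith, by linarith⟩
      · rw [abs_of_nonneg (by linarith : 0 ≤ m + t)]
        linarith
    exact (mul_pos (mul_pos (sub_pos.2 hA) (sub_pos.2 ht2)) hs2).ne'
  have hz2 := measure_mono_null hsub hz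
  rw [Measure.volume_eq_prod, Measure.prod_prod] at hz2
  exact (mul_ne_zero (aux_setpos2 hφ d hd0).ne' (aux_setpos hg m hm0).ne') hz2

/-- Under the general symmetric pricing model, given all others bid according to
prediction, utility `i`'s expected cost is minimized at `μ = 0`, nondecreasing in
`|μ|`, and strictly increasing in `|μ|` when `p` is strictly increasing or
`b₁ > b₂`. (Theorem 6, part 1.) -/
theorem general_pricing_cost_minimized_at_zero
    (p : ℝ → ℝ) (hodd : ∀ x, p (-x) = -p x) (hmono : Monotone p)
    (hcont : Filter.Tendsto p (nhds 0) (nhds 0))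
    (b₁ b₂ pd : ℝ) (hb : b₁ + b₂ = 2) (hb12 : b₂ ≤ b₁) (hb2 : 0 < b₂)
    (hpd : 0 < pd)
    (φ g : ℝ → ℝ) (hφ : SymmUnimodal φ 0) (hg : SymmUnimodal g 0)
    (D : ℝ) (hD : 0 < D)
    (C : ℝ → ℝ)
    (hC : ∀ μ, C μ = ∫ x : ℝ × ℝ,
      (pd + x.1 * (genSpot p b₁ b₂ pd (x.1 + x.2) - pd) / D)
        * (φ (x.1 - μ) * g x.2))
    (hint : ∀ μ, Integrable (fun x : ℝ × ℝ =>
      (pd + x.1 * (genSpot p b₁ b₂ pd (x.1 + x.2) - pd) / D)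
        * (φ (x.1 - μ) * g x.2))) :
    (∀ μ : ℝ, C 0 ≤ C μ) ∧
    (∀ μ₁ μ₂ : ℝ, |μ₂| ≤ |μ₁| → C μ₂ ≤ C μ₁) ∧
    ((StrictMono p ∨ b₂ < b₁) →
      ∀ μ₁ μ₂ : ℝ, |μ₂| < |μ₁| → C μ₂ < C μ₁) := by
  obtain ⟨q, hq⟩ : ∃ q : ℝ → ℝ, ∀ x, q x = genSpot p b₁ b₂ pd x - pd := ⟨_, fun _ => rfl⟩
  have hp0 : p 0 = 0 := by
    have := hodd 0
    simp only [neg_zero] at this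
    linarith
  have hb1 : b₂ = 2 - b₁ := by linarith
  have hb1' : 0 ≤ (b₁ - 1) * pd := mul_nonneg (by linarith) hpd.le
  have qpos : ∀ x, 0 < x → q x = p x + (b₁ - 1) * pd := by
    intro x hx
    rw [hq, genSpot, if_pos hx]; ring
  have qneg : ∀ x, x < 0 → q x = p x - (b₁ - 1) * pd := by
    intro x hx
    rw [hq, genSpot, if_neg hx.not_gt, if_pos hx, hb1]; ring
  have q0 : q 0 = 0 := by
    rw [hq, genSpot]; simp
  have qodd : ∀ x, q (-x) = -q x := by
    intro x
    rcases lt_trichotomy x 0 with h | h | h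
    · rw [qneg x h, qpos (-x) (by linarith), hodd]; ring
    · simp [h, q0]
    · rw [qpos x h, qneg (-x) (by linarith), hodd]; ring
  have qmono : Monotone q := by
    intro x y hxy
    have hp := hmono hxy
    rcases lt_trichotomy x 0 with h | h | h <;> rcases lt_trichotomy y 0 with h' | h' | h'
    · rw [qneg x h, qneg y h']; linarith
    · subst h'; rw [qneg x h, q0]; linarith
    · rw [qneg x h, qpos y h']; linarith
    · linarith
    · rw [h, h']
    · subst h; rw [q0, qpos y h']; linarith
    · linarith
    · linarith
    · rw [qpos x h, qpos y h']; linarith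
  have qstrict : (StrictMono p ∨ b₂ < b₁) → ∀ x, 0 < x → 0 < q x := by
    intro h x hx
    rw [qpos x hx]
    rcases h with h | h
    · have := h hx
      linarith
    · have := hmono hx.le
      have : 0 < (b₁ - 1) * pd := mul_pos (by linarith) hpd
      linarith
  let J : ℝ → ℝ × ℝ → ℝ := fun μ x => x.1 * q (x.1 + x.2) * (φ (x.1 - μ) * g x.2)
  have hJ : ∀ μ x, J μ x = x.1 * q (x.1 + x.2) * (φ (x.1 - μ) * g x.2) := fun _ _ => rfl
  have hd : ∀ μ, Integrable (fun x : ℝ × ℝ => φ (x.1 - μ) * g x.2) := fun μ =>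
    ((aux_integrable hφ).comp_sub_right μ).mul_prod (aux_integrable hg)
  have hd1 : ∀ μ, ∫ x : ℝ × ℝ, φ (x.1 - μ) * g x.2 = 1 := by
    intro μ
    rw [Measure.volume_eq_prod, integral_prod_mul (fun x => φ (x - μ)) g,
      integral_sub_right_eq_self φ μ, hφ.1.2.2, hg.1.2.2, one_mul]
  have hi : ∀ μ, Integrable (J μ) := by
    intro μ
    have := (((hint μ).sub ((hd μ).const_mul pd)).const_mul D)
    refine this.congr (Filter.Eventually.of_forall fun x => ?_)
    simp only [Pi.sub_apply, hJ, hq]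
    field_simp
    ring
  have hCJ : ∀ μ, C μ = pd + (∫ x, J μ x) / D := by
    intro μ
    have h1 := integral_add ((hd μ).const_mul pd) ((hi μ).div_const D)
    rw [integral_const_mul, hd1, integral_div, mul_one] at h1
    rw [hC, ← h1]
    congr 1
    funext x
    simp only [hJ, hq]
    ring
  have hJeven : ∀ μ, ∫ x, J (-μ) x = ∫ x, J μ x := by
    intro μ
    rw [← (aux_comp (aux_T _ _ aux_neg aux_neg) (hi μ)).2]
    congr 1
    funext x
    simp only [hJ]
    rw [show -x.1 + -x.2 = -(x.1 + x.2) by ring, qodd,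
      show -x.1 - μ = -(x.1 - -μ) by ring, aux_even hφ, aux_even hg]
    ring
  have hCabs : ∀ μ, C μ = C |μ| := by
    intro μ
    rcases abs_choice μ with h | h
    · rw [h]
    · rw [h, hCJ, hCJ, hJeven]
  have key := aux_main q qodd qmono hφ hg J hJ hi
  have hM : ∀ μ₁ μ₂ : ℝ, |μ₂| ≤ |μ₁| → C μ₂ ≤ C μ₁ := by
    intro μ₁ μ₂ h
    rw [hCabs μ₁, hCabs μ₂]
    rcases h.lt_or_eq with h | h
    · rw [hCJ, hCJ]
      have := (key _ _ (abs_nonneg μ₂) h).1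
      gcongr
    · rw [h]
  refine ⟨fun μ => hM μ 0 (by simp), hM, fun hs μ₁ μ₂ h => ?_⟩
  rw [hCabs μ₁, hCabs μ₂, hCJ, hCJ]
  have := (key _ _ (abs_nonneg μ₂) h).2 (qstrict hs)
  gcongr
end

section
/- Let σ_i > 0, σ_{−i} > 0, and ρ ∈ [0, 1). Define U(μ) := ∫_ℝ x · erf( ( x/σ_{−i} + ρ·(x − μ)/σ_i ) / √(2(1−ρ²)) ) · (1/(√(2π)σ_i)) e^{−(x−μ)²/(2σ_i²)} dx, where erf(z) = (2/√π)·∫₀ᶻ e^{−t²} dt. Then U(−μ) = U(μ) for all μ ∈ ℝ, and U(μ) > U(0) for every μ ≠ 0; i.e., μ = 0 is the unique minimizer of U. Consequently, under piecewise-linear symmetric pricing with b₁ > b₂ and nonnegatively correlated zero-mean Gaussian prediction errors, given μ_{−i} = 0 the expected average buying cost of utility i is uniquely minimized at μ_i = 0, so the all-zero profile is a pure strategy Nash equilibrium. -/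
open MeasureTheory intervalIntegral

/-- The Gauss error function `erf z = (2/√π) ∫₀ᶻ e^{-t²} dt`. -/
noncomputable def erf (z : ℝ) : ℝ :=
  (2 / Real.sqrt Real.pi) * ∫ t in (0 : ℝ)..z, Real.exp (-t ^ 2)

lemma cont_expsq : Continuous (fun t : ℝ => Real.exp (-t ^ 2)) := by fun_prop

lemma integrable_expsq : Integrable (fun t : ℝ => Real.exp (-t ^ 2)) := by
  simpa using integrable_exp_neg_mul_sq (b := 1) one_pos

lemma erf_neg' (z : ℝ) : erf (-z) = - erf z := by
  unfold erf
  have h := intervalIntegral.integral_comp_neg (a := 0) (b := z)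
    (fun t : ℝ => Real.exp (-t ^ 2))
  simp only [neg_sq, neg_zero] at h
  rw [h, intervalIntegral.integral_symm]
  ring

lemma erf_strictMono : StrictMono erf := by
  intro a b hab
  unfold erf
  have hc : 0 < 2 / Real.sqrt Real.pi := by positivity
  apply mul_lt_mul_of_pos_left _ hc
  have h := intervalIntegral.integral_interval_sub_left (μ := volume)
    (cont_expsq.intervalIntegrable 0 b) (cont_expsq.intervalIntegrable 0 a)
  have h2 : 0 < ∫ t in a..b, Real.exp (-t ^ 2) :=
    intervalIntegral.intervalIntegral_pos_of_pos (cont_expsq.intervalIntegrable a b)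
      (fun t => Real.exp_pos _) hab
  linarith

lemma erf_zero' : erf 0 = 0 := by simp [erf]

lemma erf_cont : Continuous erf := by
  unfold erf
  exact continuous_const.mul
    (intervalIntegral.continuous_primitive (fun a b => cont_expsq.intervalIntegrable a b) 0)

lemma erf_bdd : ∃ C, ∀ z, |erf z| ≤ C := by
  refine ⟨(2 / Real.sqrt Real.pi) * ∫ t : ℝ, Real.exp (-t ^ 2), fun z => ?_⟩
  unfold erf
  have hc : 0 < 2 / Real.sqrt Real.pi := by positivity
  rw [abs_mul, abs_of_pos hc]
  apply mul_le_mul_of_nonneg_left _ hc.le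
  have h := intervalIntegral.norm_integral_le_integral_norm_uIoc
    (f := fun t : ℝ => Real.exp (-t ^ 2)) (a := 0) (b := z) (μ := volume)
  rw [Real.norm_eq_abs] at h
  refine h.trans ?_
  simp only [Real.norm_eq_abs, Real.abs_exp]
  exact setIntegral_le_integral integrable_expsq
    (Filter.Eventually.of_forall fun t => (Real.exp_pos _).le)

lemma yerf_even (y : ℝ) : (-y) * erf (-y) = y * erf y := by rw [erf_neg']; ring

lemma yerf_abs (y : ℝ) : |y| * erf |y| = y * erf y := by
  rcases abs_choice y with h | h <;> rw [h]
  exact yerf_even y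

lemma yerf_lt {x y : ℝ} (h : |x| < |y|) : x * erf x < y * erf y := by
  rw [← yerf_abs x, ← yerf_abs y]
  have h1 := erf_strictMono h
  have h0 : 0 ≤ erf |x| := by
    rw [← erf_zero']; exact erf_strictMono.monotone (abs_nonneg x)
  have := abs_nonneg x
  nlinarith

/-- One-dimensional Anderson-type inequality. -/
lemma anderson (H g : ℝ → ℝ) (hHe : ∀ x, H (-x) = H x) (hge : ∀ x, g (-x) = g x)
    (hH : ∀ x y, |x| < |y| → H x < H y) (hg : ∀ x y, |x| < |y| → g y < g x)
    (hi : ∀ c, Integrable (fun u => H (u + c) * g u)) (T : ℝ) (hT : T ≠ 0) :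
    ∫ u, H u * g u < ∫ u, H (u + T) * g u := by
  obtain ⟨d, rfl⟩ : ∃ d, T = d + d := ⟨T / 2, by ring⟩
  have hd : d ≠ 0 := by rintro rfl; simp at hT
  have i1 : Integrable (fun u => H (u + d) * g (u - d)) := by
    have := (hi (d + d)).comp_sub_right d
    refine this.congr (Filter.Eventually.of_forall fun u => ?_)
    simp only; congr 2; ring
  have i2 : Integrable (fun u => H (u + d) * g (u + d)) := by
    have := (hi 0).comp_add_right d
    simpa using this
  have i3 : Integrable (fun u => H (u - d) * g (u + d)) := by
    have := i1.comp_neg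
    refine this.congr (Filter.Eventually.of_forall fun u => ?_)
    simp only
    rw [← hHe (u - d), ← hge (u + d)]; congr 2 <;> ring
  have i4 : Integrable (fun u => H (u - d) * g (u - d)) := by
    have := (hi 0).comp_sub_right d
    simpa using this
  have e1 : ∫ u, H (u + d) * g (u - d) = ∫ u, H (u + (d + d)) * g u := by
    rw [← MeasureTheory.integral_sub_right_eq_self (fun u => H (u + (d + d)) * g u) d]
    congr 1; ext u; congr 2; ring
  have e2 : ∫ u, H (u + d) * g (u + d) = ∫ u, H u * g u :=
    MeasureTheory.integral_add_right_eq_self (fun u => H u * g u) d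
  have e4 : ∫ u, H (u - d) * g (u - d) = ∫ u, H u * g u :=
    MeasureTheory.integral_sub_right_eq_self (fun u => H u * g u) d
  have e3 : ∫ u, H (u - d) * g (u + d) = ∫ u, H (u + (d + d)) * g u := by
    rw [← e1, ← MeasureTheory.integral_neg_eq_self (fun u => H (u + d) * g (u - d))]
    congr 1; ext u
    rw [← hHe (u - d), ← hge (u + d)]; congr 2 <;> ring
  have key : ∀ u, u ≠ 0 → 0 < (H (u + d) * g (u - d) - H (u + d) * g (u + d))
      + (H (u - d) * g (u + d) - H (u - d) * g (u - d)) := by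
    intro u hu
    have hud : u * d ≠ 0 := mul_ne_zero hu hd
    have : (H (u + d) * g (u - d) - H (u + d) * g (u + d))
      + (H (u - d) * g (u + d) - H (u - d) * g (u - d))
      = (H (u + d) - H (u - d)) * (g (u - d) - g (u + d)) := by ring
    rw [this]
    rcases lt_or_gt_of_ne hud with h | h
    · have : |u + d| < |u - d| := sq_lt_sq.mp (by nlinarith)
      have a := hH _ _ this
      have b := hg _ _ this
      exact mul_pos_of_neg_of_neg (by linarith) (by linarith)
    · have : |u - d| < |u + d| := sq_lt_sq.mp (by nlinarith)
      have a := hH _ _ this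
      have b := hg _ _ this
      exact mul_pos (by linarith) (by linarith)
  have hpos : 0 < ∫ u, ((H (u + d) * g (u - d) - H (u + d) * g (u + d))
      + (H (u - d) * g (u + d) - H (u - d) * g (u - d))) := by
    rw [MeasureTheory.integral_pos_iff_support_of_nonneg_ae]
    · refine lt_of_lt_of_le ?_ (measure_mono (s := Set.Ioo (0:ℝ) 1) ?_)
      · simp
      · intro u hu
        exact (key u hu.1.ne').ne'
    · have : ∀ᵐ u : ℝ, u ≠ 0 := by
        simp [ae_iff]
      filter_upwards [this] with u hu
      exact (key u hu).le
    · exact (i1.sub i2).add (i3.sub i4)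
  have hs : ∫ u, ((H (u + d) * g (u - d) - H (u + d) * g (u + d))
      + (H (u - d) * g (u + d) - H (u - d) * g (u - d)))
      = ((∫ u, H (u + (d + d)) * g u) - ∫ u, H u * g u)
       + ((∫ u, H (u + (d + d)) * g u) - ∫ u, H u * g u) := by
    have j1 : Integrable (fun u => H (u + d) * g (u - d) - H (u + d) * g (u + d)) := i1.sub i2
    have j2 : Integrable (fun u => H (u - d) * g (u + d) - H (u - d) * g (u - d)) := i3.sub i4
    rw [MeasureTheory.integral_add j1 j2, MeasureTheory.integral_sub i1 i2,
      MeasureTheory.integral_sub i3 i4, e1, e2, e3, e4]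
  linarith

lemma integrable_abs_gauss (b : ℝ) (hb : 0 < b) :
    Integrable (fun u : ℝ => u * Real.exp (-b * u ^ 2)) :=
  integrable_mul_exp_neg_mul_sq hb

theorem correlated_gaussian_gap_term_minimized_at_zero
    (σi σmi ρ : ℝ) (hσi : 0 < σi) (hσmi : 0 < σmi)
    (hρ : ρ ∈ Set.Ico (0 : ℝ) 1)
    (U : ℝ → ℝ)
    (hU : ∀ μ, U μ = ∫ x : ℝ,
      x * erf ((x / σmi + ρ * (x - μ) / σi) / Real.sqrt (2 * (1 - ρ ^ 2)))
        * ((Real.sqrt (2 * Real.pi) * σi)⁻¹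
            * Real.exp (-(x - μ) ^ 2 / (2 * σi ^ 2)))) :
    (∀ μ : ℝ, U (-μ) = U μ) ∧
    (∀ μ : ℝ, μ ≠ 0 → U 0 < U μ) := by
  obtain ⟨hρ0, hρ1⟩ := hρ
  constructor
  · intro μ
    rw [hU, hU, ← MeasureTheory.integral_neg_eq_self]
    congr 1; ext x
    have h1 : (-x / σmi + ρ * (-x - -μ) / σi) / Real.sqrt (2 * (1 - ρ ^ 2))
      = -((x / σmi + ρ * (x - μ) / σi) / Real.sqrt (2 * (1 - ρ ^ 2))) := by ring
    have h2 : (-x - -μ) ^ 2 = (x - μ) ^ 2 := by ring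
    rw [h1, h2, erf_neg']; ring
  · intro μ hμ
    have hs : 0 < Real.sqrt (2 * (1 - ρ ^ 2)) := Real.sqrt_pos.mpr (by nlinarith)
    set s := Real.sqrt (2 * (1 - ρ ^ 2)) with hsdef
    obtain ⟨r, hr⟩ : ∃ r, r = 1 / (σmi * s) := ⟨_, rfl⟩
    obtain ⟨q, hq⟩ : ∃ q, q = ρ / (σi * s) := ⟨_, rfl⟩
    have hr0 : 0 < r := by rw [hr]; positivity
    have hq0 : 0 ≤ q := by rw [hq]; positivity
    obtain ⟨p, hp⟩ : ∃ p, p = r + q := ⟨_, rfl⟩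
    have hp0 : 0 < p := by linarith
    obtain ⟨k, hk⟩ : ∃ k, k = (Real.sqrt (2 * Real.pi) * σi)⁻¹ := ⟨_, rfl⟩
    have hk0 : 0 < k := by rw [hk]; positivity
    obtain ⟨b, hb⟩ : ∃ b, b = 1 / (2 * σi ^ 2) := ⟨_, rfl⟩
    have hb0 : 0 < b := by rw [hb]; positivity
    obtain ⟨g, hg⟩ : ∃ g : ℝ → ℝ, g = fun u => k * Real.exp (-b * u ^ 2) := ⟨_, rfl⟩
    have hgpos : ∀ u, 0 < g u := fun u => by rw [hg]; positivity
    have hge : ∀ u, g (-u) = g u := fun u => by simp [hg]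
    have hglt : ∀ x y, |x| < |y| → g y < g x := by
      intro x y h
      have h2 := sq_lt_sq.mpr h
      rw [hg]
      apply mul_lt_mul_of_pos_left _ hk0
      apply Real.exp_lt_exp.mpr
      nlinarith
    have ig : Integrable g := by
      rw [hg]; exact (integrable_exp_neg_mul_sq hb0).const_mul k
    have iug : Integrable (fun u => u * g u) := by
      rw [hg]
      refine ((integrable_abs_gauss b hb0).const_mul k).congr
        (Filter.Eventually.of_forall fun u => ?_)
      simp only; ring
    obtain ⟨C, hC⟩ := erf_bdd
    have ierf : ∀ c, Integrable (fun u => erf (p * u + c) * g u) := fun c =>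
      ig.bdd_mul (c := C) (erf_cont.comp (by fun_prop)).aestronglyMeasurable
        (Filter.Eventually.of_forall fun u => hC _)
    have iuerf : ∀ c, Integrable (fun u => erf (p * u + c) * (u * g u)) := fun c =>
      iug.bdd_mul (c := C) (erf_cont.comp (by fun_prop)).aestronglyMeasurable
        (Filter.Eventually.of_forall fun u => hC _)
    have iH : ∀ c, Integrable (fun u => (p * u + c) * erf (p * u + c) * g u) := fun c => by
      refine (((iuerf c).const_mul p).add ((ierf c).const_mul c)).congr
        (Filter.Eventually.of_forall fun u => ?_)
      simp only [Pi.add_apply]; ring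
    have form : ∀ m, U m = p⁻¹ * ((∫ u, (p * u + r * m) * erf (p * u + r * m) * g u)
        + q * m * ∫ u, erf (p * u + r * m) * g u) := by
      intro m
      rw [hU, ← MeasureTheory.integral_const_mul, ← MeasureTheory.integral_add (iH _) ((ierf _).const_mul _),
        ← MeasureTheory.integral_const_mul, ← MeasureTheory.integral_add_right_eq_self _ m]
      congr 1; ext u
      have h1 : ((u + m) / σmi + ρ * (u + m - m) / σi) / s = p * u + r * m := by
        rw [hp, hr, hq]; field_simp; ring
      have h2 : (Real.sqrt (2 * Real.pi) * σi)⁻¹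
          * Real.exp (-(u + m - m) ^ 2 / (2 * σi ^ 2)) = g u := by
        rw [hg, hk, hb]; simp only; congr 2; ring
      rw [h1, h2]
      have h3 : u + m = p⁻¹ * ((p * u + r * m) + q * m) := by
        field_simp; rw [hp]; ring
      rw [h3]; ring
    have hA := anderson (fun u => (p * u) * erf (p * u)) g
      (fun x => by simp only [mul_neg]; exact yerf_even _) hge
      (fun x y h => yerf_lt (by
        rw [abs_mul, abs_mul]; exact mul_lt_mul_of_pos_left h (abs_pos.mpr hp0.ne')))
      hglt
      (fun c => by simpa only [mul_add] using iH (p * c)) (r * μ / p)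
      (div_ne_zero (mul_ne_zero hr0.ne' hμ) hp0.ne')
    have hT : ∀ u, p * (u + r * μ / p) = p * u + r * μ := fun u => by field_simp
    simp only [hT] at hA
    have hB : 0 ≤ μ * ∫ u, erf (p * u + r * μ) * g u := by
      have i2 := (ierf (r * μ)).comp_neg
      have e := MeasureTheory.integral_neg_eq_self (fun u => erf (p * u + r * μ) * g u) volume
      have h : 0 ≤ ∫ u, μ * (erf (p * u + r * μ) * g u + erf (p * (-u) + r * μ) * g (-u)) := by
        apply MeasureTheory.integral_nonneg
        intro u
        simp only [hge, Pi.zero_apply]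
        have h1 : erf (p * (-u) + r * μ) = - erf (p * u - r * μ) := by
          rw [← erf_neg']; congr 1; ring
        rw [h1]
        have h2 : μ * (erf (p * u + r * μ) * g u + -erf (p * u - r * μ) * g u)
          = (μ * (erf (p * u + r * μ) - erf (p * u - r * μ))) * g u := by ring
        rw [h2]
        apply mul_nonneg _ (hgpos u).le
        rcases lt_or_gt_of_ne hμ with h | h
        · have : r * μ < 0 := mul_neg_of_pos_of_neg hr0 h
          have := erf_strictMono (show p * u + r * μ < p * u - r * μ by linarith)
          nlinarith
        · have : 0 < r * μ := mul_pos hr0 h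
          have := erf_strictMono (show p * u - r * μ < p * u + r * μ by linarith)
          nlinarith
      rw [MeasureTheory.integral_const_mul, MeasureTheory.integral_add (ierf _) i2, e] at h
      linarith
    rw [form 0, form μ]
    apply mul_lt_mul_of_pos_left _ (inv_pos.mpr hp0)
    simp only [mul_zero, add_zero, zero_mul]
    have := mul_nonneg hq0 hB
    rw [← mul_assoc] at this
    linarith
end
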